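/- arXiv:2602.08330 — 2 statements merged into one kernel-verified Lean document; each statement's English description precedes it below -/
import Mathlib

section
/- Let $M^n$, $n \geq 3$, be an $n$-dimensional submanifold of an $m$-dimensional, $m \geq 4$, conformally flat Riemannian manifold $(\widetilde{M}^m, \widetilde{g})$. Then at every point of $M^n$, $\rho + \rho_N \leq \Vert H \Vert^2 + \frac{2}{n(m-2)} \sum_{j=1}^n \widetilde{Ric}(e_j, e_j) - \frac{2\widetilde{\tau}}{(m-1)(m-2)}$, where $\{e_j\}_{1 \leq j \leq n}$ is a local orthonormal frame of the tangent bundle of $M^n$. -/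
open Finset Matrix

/-- Kronecker delta (the components of the metric in an orthonormal frame). -/
noncomputable def kdelta {k : ℕ} (a b : Fin k) : ℝ := if a = b then 1 else 0

/-- The scalar curvature `tau = sum_{i<j} R(e_i, e_j, e_j, e_i)` computed from the
components of the curvature tensor in an orthonormal frame. -/
noncomputable def scalarCurv {n : ℕ} (R : Fin n → Fin n → Fin n → Fin n → ℝ) : ℝ :=
  ∑ i : Fin n, ∑ j : Fin n, if i < j then R i j j i else 0

/-- The normalized scalar curvature `rho = 2 tau / (n (n - 1))`. -/
noncomputable def normScalarCurv {n : ℕ} (R : Fin n → Fin n → Fin n → Fin n → ℝ) : ℝ :=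
  2 * scalarCurv R / ((n : ℝ) * ((n : ℝ) - 1))

/-- The normal scalar curvature `K_N = -(1/4) sum_{r,s} trace ([A_r, A_s]^2)` computed from
the shape operators (given as symmetric matrices in an orthonormal tangent frame). -/
noncomputable def KN {n p : ℕ} (A : Fin p → Matrix (Fin n) (Fin n) ℝ) : ℝ :=
  -(1 / 4) * ∑ r : Fin p, ∑ s : Fin p,
    Matrix.trace ((A r * A s - A s * A r) * (A r * A s - A s * A r))

/-- The normalized normal scalar curvature `rho_N = (2/(n(n-1))) sqrt(K_N)`. -/
noncomputable def rhoN {n p : ℕ} (A : Fin p → Matrix (Fin n) (Fin n) ℝ) : ℝ :=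
  2 / ((n : ℝ) * ((n : ℝ) - 1)) * Real.sqrt (KN A)

/-- The squared mean curvature `|H|^2 = sum_r ((1/n) trace A_r)^2` computed from the
components of the second fundamental form in adapted orthonormal frames. -/
noncomputable def meanCurvSq {n p : ℕ} (A : Fin p → Matrix (Fin n) (Fin n) ℝ) : ℝ :=
  ∑ r : Fin p, ((1 / (n : ℝ)) * ∑ i : Fin n, A r i i) ^ 2

/-- The normalized normal scalar curvature
`rho^perp = (2/(n(n-1))) sqrt( sum_{i<j} sum_{r<s} (Rperp(e_i,e_j,v_r,v_s))^2 )`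
computed from the components of the normal curvature tensor. -/
noncomputable def rhoPerp {n p : ℕ} (Rp : Fin n → Fin n → Fin p → Fin p → ℝ) : ℝ :=
  2 / ((n : ℝ) * ((n : ℝ) - 1)) *
    Real.sqrt (∑ i : Fin n, ∑ j : Fin n, ∑ r : Fin p, ∑ s : Fin p,
      if i < j ∧ r < s then Rp i j r s ^ 2 else 0)

/-- The Ricci curvature `Ric(e_b, e_c) = sum_a R(e_a, e_b, e_c, e_a)` computed from the
components of the curvature tensor in an orthonormal frame. -/
noncomputable def ambRicci {m : ℕ} (Rt : Fin m → Fin m → Fin m → Fin m → ℝ)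
    (b c : Fin m) : ℝ :=
  ∑ a : Fin m, Rt a b c a

/-- The (ambient) scalar curvature `tau = sum_{a<b} sigma(e_a, e_b) = (1/2) sum_a Ric(e_a,e_a)`. -/
noncomputable def ambScalar {m : ℕ} (Rt : Fin m → Fin m → Fin m → Fin m → ℝ) : ℝ :=
  (1 / 2) * ∑ a : Fin m, ambRicci Rt a a

section Star

variable {ι : Type*} [Fintype ι] [DecidableEq ι]

/-- The largest Laplacian eigenvalue of a star with `#T` leaves is `#T + 1`. -/
lemma sum_star_sq_sub_one_le_one (η : ι → ℝ) (hη : ∑ i, η i ^ 2 ≤ 1) (i : ι) (T : Finset ι)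
    (hi : i ∉ T) : ∑ j ∈ T, ((η i - η j) ^ 2 - 1) ≤ 1 := by
  have hsum : η i ^ 2 + ∑ j ∈ T, η j ^ 2 ≤ 1 := by
    rw [← Finset.sum_insert (f := fun k => η k ^ 2) hi]
    exact (Finset.sum_le_univ_sum_of_nonneg fun _ => sq_nonneg _).trans hη
  have hcs : (∑ j ∈ T, η j) ^ 2 ≤ #T * ∑ j ∈ T, η j ^ 2 := sq_sum_le_card_mul_sum_sq
  have hexp : ∑ j ∈ T, ((η i - η j) ^ 2 - 1)
      = #T * η i ^ 2 - 2 * η i * ∑ j ∈ T, η j + ∑ j ∈ T, η j ^ 2 - #T := by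
    simp only [sub_sq, Finset.sum_sub_distrib, Finset.sum_add_distrib, ← Finset.mul_sum,
      Finset.sum_const, nsmul_eq_mul]
    ring
  have hT : (0 : ℝ) ≤ #T := by positivity
  rw [hexp]
  nlinarith [sq_nonneg (η i + ∑ j ∈ T, η j)]

lemma sq_add_sq_le_one_of_ne {η : ι → ℝ} (hη : ∑ i, η i ^ 2 ≤ 1) {i j : ι} (hij : i ≠ j) :
    η i ^ 2 + η j ^ 2 ≤ 1 := by
  rw [← Finset.sum_pair (f := fun k => η k ^ 2) hij]
  exact (Finset.sum_le_univ_sum_of_nonneg fun _ => sq_nonneg _).trans hη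

/-- A family of pairs any two of which agree in a coordinate has a coordinate in which all of
them agree. -/
lemma exists_common_coordinate {α β : Type*} {S : Set (α × β)}
    (hS : ∀ x ∈ S, ∀ y ∈ S, x.1 = y.1 ∨ x.2 = y.2) {z : α × β} (hz : z ∈ S) :
    (∀ x ∈ S, x.1 = z.1) ∨ ∀ x ∈ S, x.2 = z.2 := by
  by_contra! hcon
  obtain ⟨⟨x, hx, hxz⟩, y, hy, hyz⟩ := hcon
  have hx2 := (hS x hx z hz).resolve_left hxz
  have hy1 := (hS y hy z hz).resolve_right hyz
  rcases hS x hx y hy with h | h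
  · exact hxz (h.trans hy1)
  · exact hyz (h.symm.trans hx2)

lemma sum_descending_pairs_le_one (η : ι → ℝ) (hη : ∑ i, η i ^ 2 ≤ 1) :
    ∑ x : ι × ι with η x.2 < η x.1 ∧ 1 < (η x.1 - η x.2) ^ 2,
      ((η x.1 - η x.2) ^ 2 - 1) ≤ 1 := by
  set S : Finset (ι × ι) := {x | η x.2 < η x.1 ∧ 1 < (η x.1 - η x.2) ^ 2} with hS
  have mem : ∀ x, x ∈ S ↔ η x.2 < η x.1 ∧ 1 < (η x.1 - η x.2) ^ 2 := by simp [hS]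
  have sign : ∀ x ∈ S, 0 < η x.1 ∧ η x.2 < 0 := by
    intro x hx
    obtain ⟨h1, h2⟩ := (mem x).1 hx
    have hne : x.1 ≠ x.2 := fun h => by rw [h] at h1; exact lt_irrefl _ h1
    have h3 := sq_add_sq_le_one_of_ne hη hne
    constructor <;> by_contra! h <;> nlinarith
  have hmeet : ∀ x ∈ (S : Set (ι × ι)), ∀ y ∈ (S : Set (ι × ι)), x.1 = y.1 ∨ x.2 = y.2 := by
    intro x hx y hy
    rw [Finset.mem_coe] at hx hy
    by_contra! hne
    have hx' := sign x hx
    have hy' := sign y hy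
    have h12 : x.1 ≠ x.2 := fun h => by rw [h] at hx'; linarith
    have h34 : y.1 ≠ y.2 := fun h => by rw [h] at hy'; linarith
    have h14 : x.1 ≠ y.2 := fun h => by rw [h] at hx'; linarith
    have h32 : y.1 ≠ x.2 := fun h => by rw [h] at hy'; linarith
    have hfour : η x.1 ^ 2 + (η x.2 ^ 2 + (η y.1 ^ 2 + η y.2 ^ 2)) ≤ 1 := by
      have : ∑ k ∈ {x.1, x.2, y.1, y.2}, η k ^ 2 ≤ 1 :=
        (Finset.sum_le_univ_sum_of_nonneg fun _ => sq_nonneg _).trans hη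
      rwa [Finset.sum_insert, Finset.sum_insert, Finset.sum_pair h34] at this
      · simpa using ⟨h32.symm, hne.2⟩
      · simpa using ⟨h12, hne.1, h14⟩
    have := ((mem x).1 hx).2
    have := ((mem y).1 hy).2
    nlinarith [sq_nonneg (η x.1 + η x.2), sq_nonneg (η y.1 + η y.2)]
  rcases S.eq_empty_or_nonempty with h0 | ⟨z, hz⟩
  · simp [h0]
  rcases exists_common_coordinate hmeet hz with hc | hc
  · have hinj : Set.InjOn Prod.snd (S : Set (ι × ι)) := fun x hx y hy hxy =>
      Prod.ext ((hc x hx).trans (hc y hy).symm) hxy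
    have hstar := sum_star_sq_sub_one_le_one η hη z.1 (S.image Prod.snd) (by
      intro hmem
      obtain ⟨x, hx, hxz⟩ := Finset.mem_image.1 hmem
      have := (sign x hx).2
      have := (sign z hz).1
      rw [hxz] at *
      linarith)
    rw [Finset.sum_image hinj] at hstar
    refine le_trans (le_of_eq (Finset.sum_congr rfl fun x hx => ?_)) hstar
    rw [hc x hx]
  · have hinj : Set.InjOn Prod.fst (S : Set (ι × ι)) := fun x hx y hy hxy =>
      Prod.ext hxy ((hc x hx).trans (hc y hy).symm)
    have hstar := sum_star_sq_sub_one_le_one η hη z.2 (S.image Prod.fst) (by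
      intro hmem
      obtain ⟨x, hx, hxz⟩ := Finset.mem_image.1 hmem
      have := (sign x hx).1
      have := (sign z hz).2
      rw [hxz] at *
      linarith)
    rw [Finset.sum_image hinj] at hstar
    refine le_trans (le_of_eq (Finset.sum_congr rfl fun x hx => ?_)) hstar
    rw [hc x hx]
    ring

/-- For a vector `η` of norm at most one, the excesses of the squared differences over `1` sum
up to at most `1` over unordered, hence to at most `2` over ordered pairs. -/
lemma sum_posPart_sq_sub_one_le_two (η : ι → ℝ) (hη : ∑ i, η i ^ 2 ≤ 1) :
    ∑ i, ∑ j, max ((η i - η j) ^ 2 - 1) 0 ≤ 2 := by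
  have key := sum_descending_pairs_le_one η hη
  rw [Finset.sum_filter, Fintype.sum_prod_type] at key
  have key' := key
  rw [Finset.sum_comm] at key'
  have hsplit : ∀ i j, max ((η i - η j) ^ 2 - 1) 0
      = (if η j < η i ∧ 1 < (η i - η j) ^ 2 then (η i - η j) ^ 2 - 1 else 0)
        + if η i < η j ∧ 1 < (η j - η i) ^ 2 then (η j - η i) ^ 2 - 1 else 0 := by
    intro i j
    have hsq : (η j - η i) ^ 2 = (η i - η j) ^ 2 := by ring
    rw [hsq]
    rcases lt_trichotomy (η i) (η j) with h | h | h
    · rw [if_neg fun h' => h.not_gt h'.1, zero_add]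
      split_ifs with h1
      · exact max_eq_left (by linarith [h1.2])
      · exact max_eq_right (by linarith [not_lt.1 fun h2 => h1 ⟨h, h2⟩])
    · simp [h]
    · rw [if_neg (c := η i < η j ∧ _) fun h' => h.not_gt h'.1, add_zero]
      split_ifs with h1
      · exact max_eq_left (by linarith [h1.2])
      · exact max_eq_right (by linarith [not_lt.1 fun h2 => h1 ⟨h, h2⟩])
  simp only [hsplit, Finset.sum_add_distrib]
  linarith

end Star

/-- A quadratic form with vanishing diagonal is bounded by the square of the sum on the positive
orthant as soon as its gradient is bounded in the directions of the largest coordinates. -/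
lemma sum_mul_le_sq_sum_of_max_row_le {κ : Type*} [Fintype κ] [DecidableEq κ] (c : κ → κ → ℝ)
    (hsymm : ∀ a b, c a b = c b a) (hdiag : ∀ a, c a a = 0)
    (hrow : ∀ t : κ → ℝ, (∀ a, 0 ≤ t a) → ∀ a, (∀ b, t b ≤ t a) →
      ∑ b, t b * c a b ≤ ∑ b, t b)
    (t : κ → ℝ) (ht : ∀ a, 0 ≤ t a) :
    ∑ a, ∑ b, t a * t b * c a b ≤ (∑ a, t a) ^ 2 := by
  set f : (κ → ℝ) → ℝ := fun t => ∑ a, ∑ b, t a * t b * c a b with hf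
  have hscale : ∀ (s : ℝ) (t : κ → ℝ), f (fun a => s * t a) = s ^ 2 * f t := by
    intro s t
    simp only [hf, Finset.mul_sum]
    refine Finset.sum_congr rfl fun a _ => Finset.sum_congr rfl fun b _ => by ring
  have hshift : ∀ (t : κ → ℝ) (a : κ) (s : ℝ),
      f (fun b => t b - s * if b = a then 1 else 0) = f t - 2 * s * ∑ b, t b * c a b := by
    intro t a s
    have : ∀ x y, (t x - s * if x = a then 1 else 0) * (t y - s * if y = a then 1 else 0) * c x y
        = t x * t y * c x y - (if x = a then s * (t y * c x y) else 0)
          - (if y = a then s * (t x * c x y) else 0)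
          + (if x = a then (if y = a then s ^ 2 * c x y else 0) else 0) := by
      intro x y
      split_ifs <;> ring
    simp only [hf, this, Finset.sum_add_distrib, Finset.sum_sub_distrib]
    rw [Finset.sum_comm (f := fun x y => if x = a then s * (t y * c x y) else 0),
      Finset.sum_comm (f := fun x y => if x = a then (if y = a then s ^ 2 * c x y else 0) else 0)]
    simp only [Finset.sum_ite_eq', Finset.mem_univ, if_true, hdiag, mul_zero, ← Finset.mul_sum,
      hsymm _ a]
    ring
  have hsimplex : ∀ t ∈ stdSimplex ℝ κ, f t ≤ 1 := by
    intro t₀ ht₀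
    obtain ⟨t, ht, hmax⟩ := (isCompact_stdSimplex ℝ κ).exists_isMaxOn ⟨t₀, ht₀⟩
      (f := f) (by fun_prop)
    refine (hmax ht₀).trans ?_
    show f t ≤ 1
    have hne : Nonempty κ := by
      by_contra hemp
      rw [not_nonempty_iff] at hemp
      simpa using ht.2
    obtain ⟨a, ha⟩ := Finite.exists_max t
    have hta : 0 < t a := by
      by_contra! h
      have : ∑ b, t b ≤ 0 := Finset.sum_nonpos fun b _ => (ha b).trans h
      linarith [ht.2]
    have hle := hrow t ht.1 a ha
    rw [ht.2] at hle
    by_contra! hgt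
    have hta1 : t a ≤ 1 := by
      rw [← ht.2]; exact Finset.single_le_sum (fun b _ => ht.1 b) (Finset.mem_univ a)
    -- lower the largest coordinate by `s` and rescale to the simplex
    have hvar : ∀ s, 0 < s → s < t a → f t - 2 * s ≤ (1 - s) ^ 2 * f t := by
      intro s hs hsa
      have hs1 : 0 < 1 - s := by linarith
      have hmem : (fun b => (1 - s)⁻¹ * (t b - s * if b = a then 1 else 0)) ∈ stdSimplex ℝ κ := by
        refine ⟨fun b => mul_nonneg (inv_nonneg.2 hs1.le) ?_, ?_⟩
        · split_ifs with hb
          · rw [hb]; linarith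
          · simpa using ht.1 b
        · rw [← Finset.mul_sum, Finset.sum_sub_distrib, ht.2, ← Finset.mul_sum]
          simp [hs1.ne']
      have h1 : f _ ≤ f t := hmax hmem
      rw [hscale (1 - s)⁻¹ fun b => t b - s * if b = a then 1 else 0, hshift, inv_pow,
        inv_mul_le_iff₀ (by positivity)] at h1
      nlinarith
    have hpos : 0 < f t := by linarith
    have hs := hvar (min (t a / 2) ((f t - 1) / f t)) (lt_min (by linarith)
      (div_pos (by linarith) hpos)) ((min_le_left _ _).trans_lt (by linarith))
    set s := min (t a / 2) ((f t - 1) / f t)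
    have hs0 : 0 < s := lt_min (by linarith) (div_pos (by linarith) hpos)
    have hs2 : s * f t ≤ f t - 1 := (le_div_iff₀ hpos).1 (min_le_right _ _)
    nlinarith
  rcases (Finset.sum_nonneg fun a _ => ht a).eq_or_lt with h0 | hpos
  · have hz : ∀ a, t a = 0 := fun a =>
      (Finset.sum_eq_zero_iff_of_nonneg fun a _ => ht a).1 h0.symm a (Finset.mem_univ a)
    simp [hz]
  · have h1 := hsimplex (fun a => (∑ b, t b)⁻¹ * t a)
      ⟨fun a => mul_nonneg (inv_nonneg.2 hpos.le) (ht a), by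
        rw [← Finset.mul_sum, inv_mul_cancel₀ hpos.ne']⟩
    rwa [hscale, inv_pow, inv_mul_le_iff₀ (by positivity), mul_one] at h1

section Commutator

variable {ι κ : Type*} [Fintype ι] [Fintype κ]

/-- The squared Frobenius norm of the commutator of two symmetric matrices. -/
noncomputable def commSq (X Y : Matrix ι ι ℝ) : ℝ :=
  -trace ((X * Y - Y * X) * (X * Y - Y * X))

lemma commSq_comm (X Y : Matrix ι ι ℝ) : commSq X Y = commSq Y X := by
  rw [commSq, commSq, ← neg_sub (Y * X), neg_mul_neg]

lemma trace_mul_self_eq_sum_sq {X : Matrix ι ι ℝ} (hX : X.IsSymm) :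
    trace (X * X) = ∑ i, ∑ j, X i j ^ 2 := by
  simp only [trace, diag_apply, mul_apply]
  exact Finset.sum_congr rfl fun i _ => Finset.sum_congr rfl fun j _ => by
    rw [hX.apply i j, sq]

lemma commSq_smul_smul (x y : ℝ) (X Y : Matrix ι ι ℝ) :
    commSq (x • X) (y • Y) = x ^ 2 * y ^ 2 * commSq X Y := by
  have : x • X * y • Y - y • Y * x • X = (x * y) • (X * Y - Y * X) := by
    simp only [Matrix.smul_mul, Matrix.mul_smul, smul_sub, smul_smul, mul_comm y x]
  rw [commSq, this]
  simp only [Matrix.smul_mul, Matrix.mul_smul, trace_smul, smul_eq_mul, commSq]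
  ring

lemma trace_mul_self_nonneg {X : Matrix ι ι ℝ} (hX : X.IsSymm) : 0 ≤ trace (X * X) := by
  rw [trace_mul_self_eq_sum_sq hX]
  positivity

lemma eq_zero_of_trace_mul_self {X : Matrix ι ι ℝ} (hX : X.IsSymm) (h0 : trace (X * X) = 0) :
    X = 0 := by
  rw [trace_mul_self_eq_sum_sq hX] at h0
  ext i j
  have hrow := (Finset.sum_eq_zero_iff_of_nonneg fun i _ => Finset.sum_nonneg fun j _ =>
    sq_nonneg (X i j)).1 h0 i (Finset.mem_univ i)
  have hentry := (Finset.sum_eq_zero_iff_of_nonneg fun j _ => sq_nonneg (X i j)).1 hrow j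
    (Finset.mem_univ j)
  exact (pow_eq_zero_iff two_ne_zero).1 hentry

variable [DecidableEq ι]

lemma commSq_diagonal (η : ι → ℝ) {X : Matrix ι ι ℝ} (hX : X.IsSymm) :
    commSq (diagonal η) X = ∑ i, ∑ j, (η i - η j) ^ 2 * X i j ^ 2 := by
  simp only [commSq, trace, diag_apply, mul_apply (M := _ - _), Matrix.sub_apply, diagonal_mul,
    mul_diagonal, ← Finset.sum_neg_distrib]
  exact Finset.sum_congr rfl fun i _ => Finset.sum_congr rfl fun j _ => by
    rw [hX.apply i j]; ring

lemma trace_conj_mul_conj {V : Matrix ι ι ℝ} (hV : Vᵀ * V = 1) (X Y : Matrix ι ι ℝ) :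
    trace ((V * X * Vᵀ) * (V * Y * Vᵀ)) = trace (X * Y) := by
  have : (V * X * Vᵀ) * (V * Y * Vᵀ) = V * (X * Y * Vᵀ) := by
    simp only [Matrix.mul_assoc]
    rw [← Matrix.mul_assoc Vᵀ V, hV, Matrix.one_mul]
  rw [this, trace_mul_comm, Matrix.mul_assoc, hV, Matrix.mul_one]

lemma commSq_conj {V : Matrix ι ι ℝ} (hV : Vᵀ * V = 1) (X Y : Matrix ι ι ℝ) :
    commSq (V * X * Vᵀ) (V * Y * Vᵀ) = commSq X Y := by
  have hmul : ∀ X Y : Matrix ι ι ℝ, (V * X * Vᵀ) * (V * Y * Vᵀ) = V * (X * Y) * Vᵀ := by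
    intro X Y
    simp only [Matrix.mul_assoc]
    rw [← Matrix.mul_assoc Vᵀ V, hV, Matrix.one_mul]
  rw [commSq, hmul, hmul, ← Matrix.sub_mul, ← Matrix.mul_sub, trace_conj_mul_conj hV, commSq]

/-- Bessel's inequality for the off-diagonal entries of an orthogonal family of symmetric
matrices. -/
lemma sum_entry_sq_le_half {X : κ → Matrix ι ι ℝ} (hX : ∀ a, (X a).IsSymm)
    (horth : ∀ a b, a ≠ b → trace (X a * X b) = 0) (hnorm : ∀ a, trace (X a * X a) ≤ 1)
    {i j : ι} (hij : i ≠ j) : ∑ a, X a i j ^ 2 ≤ 1 / 2 := by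
  set S := ∑ a, X a i j ^ 2 with hS
  set Y : Matrix ι ι ℝ := ∑ a, X a i j • X a with hY
  have hYsymm : Y.IsSymm := by
    simp only [hY, Matrix.IsSymm, transpose_sum, transpose_smul, (hX _).eq]
  have hYij : Y i j = S := by
    simp [hY, hS, Matrix.sum_apply, sq]
  have hYnorm : trace (Y * Y) ≤ S := by
    have : trace (Y * Y) = ∑ a, X a i j ^ 2 * trace (X a * X a) := by
      simp only [hY, Finset.sum_mul, Finset.mul_sum, trace_sum, Matrix.smul_mul, Matrix.mul_smul, trace_smul,
        smul_eq_mul]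
      refine Finset.sum_congr rfl fun a _ => ?_
      rw [Finset.sum_eq_single a (fun b _ hb => by rw [horth b a hb]; ring) (by simp)]
      ring
    rw [this]
    exact Finset.sum_le_sum fun a _ => mul_le_of_le_one_right (sq_nonneg _) (hnorm a)
  have hlow : 2 * S ^ 2 ≤ trace (Y * Y) := by
    rw [trace_mul_self_eq_sum_sq hYsymm]
    calc 2 * S ^ 2 = ∑ x ∈ {(i, j), (j, i)}, Y x.1 x.2 ^ 2 := by
          rw [Finset.sum_pair (by simp [hij])]
          simp only [hYsymm.apply i j, hYij]
          ring
      _ ≤ ∑ x : ι × ι, Y x.1 x.2 ^ 2 := Finset.sum_le_univ_sum_of_nonneg fun _ => sq_nonneg _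
      _ = _ := Fintype.sum_prod_type _
  by_contra! h
  nlinarith

lemma sum_mul_commSq_diagonal_le (η : ι → ℝ) (hη : ∑ i, η i ^ 2 ≤ 1)
    {X : κ → Matrix ι ι ℝ} (hX : ∀ a, (X a).IsSymm)
    (horth : ∀ a b, a ≠ b → trace (X a * X b) = 0) (hnorm : ∀ a, trace (X a * X a) ≤ 1)
    (t : κ → ℝ) (ht : ∀ a, 0 ≤ t a) {T : ℝ} (hT0 : 0 ≤ T) (hT : ∀ a, t a ≤ T) :
    ∑ a, t a * commSq (diagonal η) (X a) ≤ ∑ a, t a + T := by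
  set w : ι → ι → ℝ := fun i j => max ((η i - η j) ^ 2 - 1) 0 with hw
  have hw0 : ∀ i j, 0 ≤ w i j := fun i j => le_max_right _ _
  have hterm : ∀ a, t a * commSq (diagonal η) (X a)
      ≤ t a + T * ∑ i, ∑ j, w i j * X a i j ^ 2 := by
    intro a
    have h1 : commSq (diagonal η) (X a) ≤ trace (X a * X a) + ∑ i, ∑ j, w i j * X a i j ^ 2 := by
      rw [commSq_diagonal η (hX a), trace_mul_self_eq_sum_sq (hX a), ← Finset.sum_add_distrib]
      refine Finset.sum_le_sum fun i _ => ?_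
      rw [← Finset.sum_add_distrib]
      refine Finset.sum_le_sum fun j _ => ?_
      have : (η i - η j) ^ 2 - 1 ≤ w i j := le_max_left _ _
      nlinarith [sq_nonneg (X a i j)]
    have h2 : 0 ≤ ∑ i, ∑ j, w i j * X a i j ^ 2 :=
      Finset.sum_nonneg fun i _ => Finset.sum_nonneg fun j _ =>
        mul_nonneg (hw0 i j) (sq_nonneg _)
    nlinarith [ht a, hT a, hnorm a, mul_le_mul_of_nonneg_left (h1.trans
      (add_le_add_left (hnorm a) _)) (ht a), mul_le_mul_of_nonneg_right (hT a) h2]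
  have hexcess : ∑ a, ∑ i, ∑ j, w i j * X a i j ^ 2 ≤ 1 := by
    rw [Finset.sum_comm]
    calc ∑ i, ∑ a, ∑ j, w i j * X a i j ^ 2 ≤ ∑ i, ∑ j, w i j * (1 / 2) := by
          refine Finset.sum_le_sum fun i _ => ?_
          rw [Finset.sum_comm]
          refine Finset.sum_le_sum fun j _ => ?_
          rw [← Finset.mul_sum]
          rcases eq_or_ne i j with rfl | hij
          · simp [hw]
          · exact mul_le_mul_of_nonneg_left (sum_entry_sq_le_half hX horth hnorm hij) (hw0 i j)
      _ = (∑ i, ∑ j, w i j) * (1 / 2) := by simp only [Finset.sum_mul]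
      _ ≤ 1 := by linarith [sum_posPart_sq_sub_one_le_two η hη]
  calc ∑ a, t a * commSq (diagonal η) (X a)
      ≤ ∑ a, (t a + T * ∑ i, ∑ j, w i j * X a i j ^ 2) := Finset.sum_le_sum fun a _ => hterm a
    _ = ∑ a, t a + T * ∑ a, ∑ i, ∑ j, w i j * X a i j ^ 2 := by
        rw [Finset.sum_add_distrib, ← Finset.mul_sum]
    _ ≤ ∑ a, t a + T := by nlinarith

lemma exists_orthogonal_diagonalization {A : Matrix ι ι ℝ} (hA : A.IsSymm) :
    ∃ (V : Matrix ι ι ℝ) (η : ι → ℝ), Vᵀ * V = 1 ∧ V * Vᵀ = 1 ∧ A = V * diagonal η * Vᵀ := by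
  have hH : A.IsHermitian := by
    rw [Matrix.IsHermitian, conjTranspose_eq_transpose_of_trivial, hA.eq]
  have hstar : star (hH.eigenvectorUnitary : Matrix ι ι ℝ)
      = (hH.eigenvectorUnitary : Matrix ι ι ℝ)ᵀ := by
    rw [star_eq_conjTranspose, conjTranspose_eq_transpose_of_trivial]
  refine ⟨hH.eigenvectorUnitary, hH.eigenvalues, ?_, ?_, ?_⟩
  · rw [← hstar]; exact Unitary.coe_star_mul_self _
  · rw [← hstar]; exact Unitary.coe_mul_star_self _
  · rw [← hstar]
    exact hH.spectral_theorem

/-- The key commutator estimate: for a symmetric matrix `A` of norm at most one and an orthogonal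
family `X` of symmetric matrices of norm at most one,
`∑ t_a ‖[A, X_a]‖² ≤ ∑ t_a + max t_a`. -/
lemma sum_mul_commSq_le {A : Matrix ι ι ℝ} (hA : A.IsSymm) (hA1 : trace (A * A) ≤ 1)
    {X : κ → Matrix ι ι ℝ} (hX : ∀ a, (X a).IsSymm)
    (horth : ∀ a b, a ≠ b → trace (X a * X b) = 0) (hnorm : ∀ a, trace (X a * X a) ≤ 1)
    (t : κ → ℝ) (ht : ∀ a, 0 ≤ t a) {T : ℝ} (hT0 : 0 ≤ T) (hT : ∀ a, t a ≤ T) :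
    ∑ a, t a * commSq A (X a) ≤ ∑ a, t a + T := by
  obtain ⟨V, η, hV, hV', rfl⟩ := exists_orthogonal_diagonalization hA
  have hη : ∑ i, η i ^ 2 ≤ 1 := by
    rw [trace_conj_mul_conj hV, diagonal_mul_diagonal, trace_diagonal] at hA1
    simpa only [sq] using hA1
  have hconj : ∀ a b, trace ((Vᵀ * X a * V) * (Vᵀ * X b * V)) = trace (X a * X b) := fun a b => by
    simpa using trace_conj_mul_conj (V := Vᵀ) (by simpa using hV') (X a) (X b)
  have hback : ∀ a, V * (Vᵀ * X a * V) * Vᵀ = X a := fun a => by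
    simp only [Matrix.mul_assoc, hV', Matrix.mul_one]
    rw [← Matrix.mul_assoc, hV', Matrix.one_mul]
  have key := sum_mul_commSq_diagonal_le η hη (X := fun a => Vᵀ * X a * V)
    (fun a => by simp [Matrix.IsSymm, transpose_mul, (hX a).eq, Matrix.mul_assoc])
    (fun a b hab => by rw [hconj, horth a b hab])
    (fun a => by rw [hconj]; exact hnorm a) t ht hT0 hT
  refine le_trans (le_of_eq (Finset.sum_congr rfl fun a _ => ?_)) key
  rw [← commSq_conj hV (diagonal η) (Vᵀ * X a * V), hback]

variable [DecidableEq κ]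

lemma sum_commSq_le_of_orthonormal {X : κ → Matrix ι ι ℝ} (hX : ∀ a, (X a).IsSymm)
    (horth : ∀ a b, a ≠ b → trace (X a * X b) = 0) (hnorm : ∀ a, trace (X a * X a) ≤ 1)
    (t : κ → ℝ) (ht : ∀ a, 0 ≤ t a) :
    ∑ a, ∑ b, t a * t b * commSq (X a) (X b) ≤ (∑ a, t a) ^ 2 := by
  have hdiag : ∀ a, commSq (X a) (X a) = 0 := fun a => by simp [commSq]
  refine sum_mul_le_sq_sum_of_max_row_le (fun a b => commSq (X a) (X b))
    (fun a b => commSq_comm _ _) hdiag (fun t ht a ha => ?_) t ht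
  have key := sum_mul_commSq_le (hX a) (hnorm a) hX horth hnorm (fun b => if b = a then 0 else t b)
    (fun b => by split_ifs <;> simp [ht b]) (ht a)
    (fun b => by split_ifs <;> simp [ht a, ha b])
  have h1 : ∑ b, (if b = a then 0 else t b) + t a = ∑ b, t b := by
    rw [← Finset.add_sum_erase _ t (Finset.mem_univ a), ← Finset.add_sum_erase _ _
      (Finset.mem_univ a), if_pos rfl, zero_add, add_comm]
    congr 1
    exact Finset.sum_congr rfl fun b hb => if_neg (Finset.ne_of_mem_erase hb)
  rw [h1] at key
  refine le_trans (le_of_eq (Finset.sum_congr rfl fun b _ => ?_)) key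
  split_ifs with hb
  · rw [hb, hdiag]; simp
  · rfl

lemma sum_commSq_le_of_orthogonal {A : κ → Matrix ι ι ℝ} (hA : ∀ a, (A a).IsSymm)
    (horth : ∀ a b, a ≠ b → trace (A a * A b) = 0) :
    ∑ a, ∑ b, commSq (A a) (A b) ≤ (∑ a, trace (A a * A a)) ^ 2 := by
  set s : κ → ℝ := fun a => Real.sqrt (trace (A a * A a)) with hs
  have hsq : ∀ a, s a ^ 2 = trace (A a * A a) := fun a =>
    Real.sq_sqrt (trace_mul_self_nonneg (hA a))
  have hunit : ∀ a, A a = s a • ((s a)⁻¹ • A a) := by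
    intro a
    rcases eq_or_ne (s a) 0 with h0 | h0
    · rw [eq_zero_of_trace_mul_self (hA a) (by rw [← hsq, h0]; simp)]
      simp
    · rw [smul_smul, mul_inv_cancel₀ h0, one_smul]
  have htr : ∀ a b, trace (((s a)⁻¹ • A a) * ((s b)⁻¹ • A b))
      = (s a)⁻¹ * (s b)⁻¹ * trace (A a * A b) := by
    intro a b
    simp only [Matrix.smul_mul, Matrix.mul_smul, trace_smul, smul_eq_mul]
    ring
  have key := sum_commSq_le_of_orthonormal (X := fun a => (s a)⁻¹ • A a)
    (fun a => (hA a).smul _)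
    (fun a b hab => by rw [htr, horth a b hab, mul_zero])
    (fun a => by
      rw [htr, ← hsq]
      rcases eq_or_ne (s a) 0 with h0 | h0
      · simp [h0]
      · exact le_of_eq (by field_simp))
    (fun a => s a ^ 2) (fun a => sq_nonneg _)
  simp only [hsq] at key
  refine le_trans (le_of_eq ?_) key
  refine Finset.sum_congr rfl fun a _ => Finset.sum_congr rfl fun b _ => ?_
  rw [← hsq a, ← hsq b, ← commSq_smul_smul, ← hunit, ← hunit]

lemma sum_rotate {E : Type*} [AddCommGroup E] [Module ℝ E] (β : E →ₗ[ℝ] E →ₗ[ℝ] ℝ)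
    {U : Matrix κ κ ℝ} (hU : U * Uᵀ = 1) (A : κ → E) :
    ∑ a, β (∑ r, U r a • A r) (∑ r, U r a • A r) = ∑ r, β (A r) (A r) := by
  have hentry : ∀ r s, ∑ a, U r a * U s a = if r = s then 1 else 0 := fun r s => by
    rw [← Matrix.one_apply, ← hU]; rfl
  simp only [map_sum, map_smul, LinearMap.sum_apply, LinearMap.smul_apply, smul_eq_mul,
    Finset.mul_sum]
  rw [Finset.sum_comm]
  refine Finset.sum_congr rfl fun r _ => ?_
  rw [Finset.sum_comm]
  calc _ = ∑ s, (∑ a, U s a * U r a) * β (A s) (A r) := by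
        refine Finset.sum_congr rfl fun s _ => ?_
        rw [Finset.sum_mul]
        exact Finset.sum_congr rfl fun a _ => by ring
    _ = β (A r) (A r) := by simp [hentry]

/-- The bilinear form polarizing `X ↦ trace (X * X)`. -/
noncomputable def traceBilin : Matrix ι ι ℝ →ₗ[ℝ] Matrix ι ι ℝ →ₗ[ℝ] ℝ :=
  (LinearMap.mul ℝ (Matrix ι ι ℝ)).compr₂ (traceLinearMap ι ℝ ℝ)

lemma sum_trace_rotate {U : Matrix κ κ ℝ} (hU : U * Uᵀ = 1) (A : κ → Matrix ι ι ℝ) :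
    ∑ a, trace ((∑ r, U r a • A r) * (∑ r, U r a • A r)) = ∑ r, trace (A r * A r) :=
  sum_rotate traceBilin hU A

lemma sum_commSq_rotate {U : Matrix κ κ ℝ} (hU : U * Uᵀ = 1) (A : κ → Matrix ι ι ℝ)
    (Y : Matrix ι ι ℝ) :
    ∑ a, commSq (∑ r, U r a • A r) Y = ∑ r, commSq (A r) Y := by
  let L : Matrix ι ι ℝ →ₗ[ℝ] Matrix ι ι ℝ := LinearMap.mulRight ℝ Y - LinearMap.mulLeft ℝ Y
  exact sum_rotate (-(traceBilin.compl₁₂ L L)) hU A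

/-- The DDVV inequality for symmetric matrices. -/
theorem sum_commSq_le_sq_sum_trace {A : κ → Matrix ι ι ℝ} (hA : ∀ r, (A r).IsSymm) :
    ∑ r, ∑ s, commSq (A r) (A s) ≤ (∑ r, trace (A r * A r)) ^ 2 := by
  set G : Matrix κ κ ℝ := of fun r s => trace (A r * A s) with hG
  have hGsymm : G.IsSymm := by
    ext r s
    simp [hG, trace_mul_comm (A r)]
  obtain ⟨U, μ, hU, hU', hGU⟩ := exists_orthogonal_diagonalization hGsymm
  set B : κ → Matrix ι ι ℝ := fun a => ∑ r, U r a • A r with hB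
  have hBsymm : ∀ a, (B a).IsSymm := fun a => by
    simp only [hB, Matrix.IsSymm, transpose_sum, transpose_smul, (hA _).eq]
  have hgram : ∀ a b, trace (B a * B b) = (Uᵀ * G * U) a b := by
    intro a b
    simp only [hB, hG, Finset.sum_mul, Finset.mul_sum, trace_sum, Matrix.smul_mul, Matrix.mul_smul, trace_smul,
      smul_eq_mul, mul_apply, transpose_apply, of_apply]
    exact Finset.sum_congr rfl fun s _ => Finset.sum_congr rfl fun r _ => by ring
  have hdiag : Uᵀ * G * U = diagonal μ := by
    rw [hGU]
    simp only [Matrix.mul_assoc, hU, Matrix.mul_one]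
    rw [← Matrix.mul_assoc, hU, Matrix.one_mul]
  have key := sum_commSq_le_of_orthogonal hBsymm fun a b hab => by
    rw [hgram, hdiag, diagonal_apply_ne _ hab]
  rw [sum_trace_rotate hU' A] at key
  refine le_trans (le_of_eq ?_) key
  calc ∑ r, ∑ s, commSq (A r) (A s) = ∑ s, ∑ r, commSq (A r) (A s) := Finset.sum_comm
    _ = ∑ s, ∑ a, commSq (A s) (B a) := by
        refine Finset.sum_congr rfl fun s _ => ?_
        rw [← sum_commSq_rotate hU' A]
        exact Finset.sum_congr rfl fun a _ => commSq_comm _ _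
    _ = ∑ a, ∑ s, commSq (A s) (B a) := Finset.sum_comm
    _ = ∑ a, ∑ b, commSq (B a) (B b) := by
        refine Finset.sum_congr rfl fun a _ => ?_
        rw [← sum_commSq_rotate hU' A]
        exact Finset.sum_congr rfl fun b _ => commSq_comm _ _

end Commutator

section Geometry

lemma sum_lt_eq_half_sum_offDiag {n : ℕ} (f : Fin n → Fin n → ℝ) (hf : ∀ i j, f i j = f j i) :
    ∑ i, ∑ j, (if i < j then f i j else 0)
      = (1 / 2) * (∑ i, ∑ j, f i j - ∑ i, f i i) := by
  have hsplit : ∀ i j, f i j = (if i < j then f i j else 0) + (if j < i then f j i else 0)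
      + if i = j then f i i else 0 := by
    intro i j
    rcases lt_trichotomy i j with h | rfl | h
    · simp [h, h.not_gt, h.ne]
    · simp
    · simp [h, h.not_gt, h.ne', hf i j]
  have hsum : ∑ i, ∑ j, f i j = 2 * ∑ i, ∑ j, (if i < j then f i j else 0) + ∑ i, f i i := by
    rw [Finset.sum_congr rfl fun i _ => Finset.sum_congr rfl fun j _ => hsplit i j]
    simp only [Finset.sum_add_distrib, Finset.sum_ite_eq, Finset.mem_univ, if_true]
    rw [Finset.sum_comm (f := fun i j => if j < i then f j i else 0)]
    ring
  rw [hsum]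
  ring

lemma commSq_sub_smul_one {ι : Type*} [Fintype ι] [DecidableEq ι] (X Y : Matrix ι ι ℝ)
    (x y : ℝ) : commSq (X - x • 1) (Y - y • 1) = commSq X Y := by
  have : (X - x • 1) * (Y - y • 1) - (Y - y • 1) * (X - x • 1) = X * Y - Y * X := by
    simp only [Matrix.sub_mul, Matrix.mul_sub, Matrix.smul_mul, Matrix.mul_smul, Matrix.one_mul,
      Matrix.mul_one]
    module
  rw [commSq, this, commSq]

/-- The Wintgen-type bound on the normal scalar curvature by the trace-free part of the second
fundamental form. -/
lemma sqrt_KN_le {n p : ℕ} (hn : 0 < n) {A : Fin p → Matrix (Fin n) (Fin n) ℝ}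
    (hA : ∀ r, (A r).IsSymm) :
    Real.sqrt (KN A) ≤ (1 / 2) * ∑ r, (trace (A r * A r) - trace (A r) ^ 2 / n) := by
  have hn' : (n : ℝ) ≠ 0 := by positivity
  set B : Fin p → Matrix (Fin n) (Fin n) ℝ := fun r => A r - (trace (A r) / n) • 1 with hB
  have hBsymm : ∀ r, (B r).IsSymm := fun r => (hA r).sub (isSymm_one.smul _)
  have htr : ∀ r, trace (B r * B r) = trace (A r * A r) - trace (A r) ^ 2 / n := by
    intro r
    simp only [hB, Matrix.sub_mul, Matrix.mul_sub, Matrix.smul_mul, Matrix.mul_smul,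
      Matrix.one_mul, Matrix.mul_one, trace_sub, trace_smul, trace_one, Fintype.card_fin,
      smul_eq_mul]
    field_simp
    ring
  have hKN : KN A = (1 / 4) * ∑ r, ∑ s, commSq (B r) (B s) := by
    simp only [hB, commSq_sub_smul_one]
    simp only [KN, commSq, Finset.sum_neg_distrib]
    ring
  have hDDVV := sum_commSq_le_sq_sum_trace hBsymm
  have hnonneg : 0 ≤ ∑ r, trace (B r * B r) :=
    Finset.sum_nonneg fun r _ => trace_mul_self_nonneg (hBsymm r)
  simp only [← htr]
  rw [Real.sqrt_le_left (by positivity), hKN]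
  linarith

end Geometry

/-- **Generalized Wintgen inequality (Proposition, inequality part).**
Let `M^n` (`n ≥ 3`) be a submanifold of an `m`-dimensional (`m ≥ 4`) conformally flat
Riemannian manifold.  Everything is expressed pointwise through the components, in adapted
orthonormal frames, of the intrinsic curvature `R`, the ambient curvature `Rt` (conformal
flatness is encoded by the vanishing of the Weyl tensor, hypothesis `weyl`), and the second
fundamental form `h` (related to `R` and `Rt` by the Gauss equation, hypothesis `gauss`).
Then `ρ + ρ_N ≤ ‖H‖² + (2/(n(m-2))) ∑_j Ric~(e_j,e_j) - 2τ~/((m-1)(m-2))`. -/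
theorem wintgen_rhoN_conformally_flat {n m : ℕ} (hn : 3 ≤ n) (hm : 4 ≤ m) (hnm : n ≤ m)
    (Rt : Fin m → Fin m → Fin m → Fin m → ℝ)
    (R : Fin n → Fin n → Fin n → Fin n → ℝ)
    (h : Fin (m - n) → Matrix (Fin n) (Fin n) ℝ)
    (hsymm : ∀ r, (h r).IsSymm)
    (weyl : ∀ x y z w : Fin m, Rt x y z w =
      (1 / ((m : ℝ) - 2)) *
        (ambRicci Rt y z * kdelta x w - ambRicci Rt x z * kdelta y w
          + ambRicci Rt x w * kdelta y z - ambRicci Rt y w * kdelta x z)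
      - (2 * ambScalar Rt / (((m : ℝ) - 1) * ((m : ℝ) - 2))) *
          (kdelta y z * kdelta x w - kdelta x z * kdelta y w))
    (gauss : ∀ i j k l : Fin n, R i j k l =
      Rt (Fin.castLE hnm i) (Fin.castLE hnm j) (Fin.castLE hnm k) (Fin.castLE hnm l)
      + ∑ r : Fin (m - n), (h r i l * h r j k - h r i k * h r j l)) :
    normScalarCurv R + rhoN h ≤ meanCurvSq h
      + 2 / ((n : ℝ) * ((m : ℝ) - 2)) *
          ∑ j : Fin n, ambRicci Rt (Fin.castLE hnm j) (Fin.castLE hnm j)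
      - 2 * ambScalar Rt / (((m : ℝ) - 1) * ((m : ℝ) - 2)) := by
  have hn0 : (0 : ℝ) < n := by positivity
  have hn1 : (0 : ℝ) < (n : ℝ) - 1 := by
    have : (3 : ℝ) ≤ n := by exact_mod_cast hn
    linarith
  have hm2 : (0 : ℝ) < (m : ℝ) - 2 := by
    have : (4 : ℝ) ≤ m := by exact_mod_cast hm
    linarith
  set K : ℝ := 2 * ambScalar Rt / (((m : ℝ) - 1) * ((m : ℝ) - 2)) with hK
  set ric : Fin n → ℝ := fun j => ambRicci Rt (Fin.castLE hnm j) (Fin.castLE hnm j) with hric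
  have hsect : ∀ i j : Fin n, i ≠ j → R i j j i = (1 / ((m : ℝ) - 2)) * (ric i + ric j) - K
      + ∑ r, (h r i i * h r j j - h r i j * h r i j) := by
    intro i j hij
    have hne : Fin.castLE hnm i ≠ Fin.castLE hnm j := by
      simpa [Fin.castLE_inj] using hij
    rw [gauss, weyl]
    simp only [kdelta, if_true, if_neg hne, if_neg hne.symm, hric, (hsymm _).apply i j]
    ring
  have hscal : scalarCurv R = (1 / 2) * (2 * (n - 1) / (m - 2) * ∑ j, ric j - n * (n - 1) * K
      + ∑ r, (trace (h r) ^ 2 - trace (h r * h r))) := by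
    have hoff : scalarCurv R = ∑ i : Fin n, ∑ j : Fin n, if i < j then
        (1 / ((m : ℝ) - 2)) * (ric i + ric j) - K
          + ∑ r, (h r i i * h r j j - h r i j * h r i j) else 0 := by
      refine Finset.sum_congr rfl fun i _ => Finset.sum_congr rfl fun j _ => ?_
      split_ifs with hij
      · exact hsect i j hij.ne
      · rfl
    have hquad : ∑ i, ∑ j, ∑ r, (h r i i * h r j j - h r i j * h r i j)
        = ∑ r, (trace (h r) ^ 2 - trace (h r * h r)) := by
      rw [Finset.sum_congr rfl fun i _ => Finset.sum_comm, Finset.sum_comm]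
      refine Finset.sum_congr rfl fun r _ => ?_
      rw [trace_mul_self_eq_sum_sq (hsymm r), sq, trace, Finset.sum_mul_sum]
      simp only [Finset.sum_sub_distrib, diag_apply, sq]
    rw [hoff, sum_lt_eq_half_sum_offDiag _ fun i j => by
      simp only [(hsymm _).apply i j, add_comm (ric i), mul_comm (h _ i i)]]
    have hfull : ∑ i : Fin n, ∑ j : Fin n, ((1 / ((m : ℝ) - 2)) * (ric i + ric j) - K
        + ∑ r, (h r i i * h r j j - h r i j * h r i j))
        = 2 * n / (m - 2) * ∑ j, ric j - n ^ 2 * K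
          + ∑ r, (trace (h r) ^ 2 - trace (h r * h r)) := by
      rw [← hquad]
      simp only [Finset.sum_add_distrib]
      congr 1
      simp only [Finset.sum_sub_distrib, ← Finset.mul_sum, Finset.sum_add_distrib,
        Finset.sum_const, Finset.card_univ, Fintype.card_fin, nsmul_eq_mul]
      ring
    have hdiag : ∑ i : Fin n, ((1 / ((m : ℝ) - 2)) * (ric i + ric i) - K
        + ∑ r, (h r i i * h r i i - h r i i * h r i i)) = 2 / (m - 2) * ∑ j, ric j - n * K := by
      simp only [sub_self, Finset.sum_const_zero, add_zero, Finset.sum_sub_distrib,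
        ← Finset.mul_sum, Finset.sum_add_distrib, Finset.sum_const, Finset.card_univ,
        Fintype.card_fin, nsmul_eq_mul]
      ring
    rw [hfull, hdiag]
    ring
  have hmean : meanCurvSq h = (∑ r, trace (h r) ^ 2) / n ^ 2 := by
    rw [meanCurvSq, Finset.sum_div]
    refine Finset.sum_congr rfl fun r _ => ?_
    change (1 / (n : ℝ) * trace (h r)) ^ 2 = _
    ring
  have hsqrt := sqrt_KN_le (by omega) hsymm
  rw [Finset.sum_sub_distrib, ← Finset.sum_div] at hsqrt
  rw [Finset.sum_sub_distrib] at hscal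
  have hcoef : 0 ≤ 2 / ((n : ℝ) * ((n : ℝ) - 1)) := by positivity
  rw [normScalarCurv, rhoN, hscal, hmean]
  refine (add_le_add_right (mul_le_mul_of_nonneg_left hsqrt hcoef) _).trans (le_of_eq ?_)
  field_simp
  ring
end

section
/- Let $M^n$, $n \geq 3$, be an $n$-dimensional minimal submanifold (i.e., one with vanishing mean curvature vector $H = 0$) of an $m$-dimensional, $m \geq 4$, conformally flat Riemannian manifold $(\widetilde{M}^m, \widetilde{g})$. Then $\rho + \rho_N \leq \frac{2}{n(m-2)} \sum_{j=1}^n \widetilde{Ric}(e_j, e_j) - \frac{2\widetilde{\tau}}{(m-1)(m-2)}$, where $\{e_j\}_{1 \leq j \leq n}$ is a local orthonormal frame of the tangent bundle of $M^n$. -/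
open Finset Matrix

lemma sum_sq_sub_le_card_add_one_mul {ι : Type*} (a : ι → ℝ) (x : ℝ) (S : Finset ι) :
    ∑ j ∈ S, (x - a j) ^ 2 ≤ ((#S : ℝ) + 1) * (x ^ 2 + ∑ j ∈ S, a j ^ 2) := by
  have hcs : (∑ j ∈ S, a j) ^ 2 ≤ (#S : ℝ) * ∑ j ∈ S, a j ^ 2 := sq_sum_le_card_mul_sum_sq
  have hexp : ∑ j ∈ S, (x - a j) ^ 2 = #S * x ^ 2 - 2 * x * ∑ j ∈ S, a j + ∑ j ∈ S, a j ^ 2 := by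
    simp only [sub_sq, sum_add_distrib, sum_sub_distrib, mul_sum, sum_const, nsmul_eq_mul]
  nlinarith [sq_nonneg (x + ∑ j ∈ S, a j)]

lemma sum_star_le_one {ι : Type*} [Fintype ι] [DecidableEq ι] {a : ι → ℝ}
    (ha : ∑ i, a i ^ 2 ≤ 1) (c : ι) (S : Finset ι) (hc : c ∉ S) :
    ∑ j ∈ S, ((a c - a j) ^ 2 - 1) ≤ 1 := by
  have h₁ := sum_sq_sub_le_card_add_one_mul a (a c) S
  have h₂ : a c ^ 2 + ∑ j ∈ S, a j ^ 2 ≤ 1 := by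
    rw [← sum_insert (f := fun j => a j ^ 2) hc]
    exact (sum_le_univ_sum_of_nonneg fun i => sq_nonneg (a i)).trans ha
  have h₃ : ((#S : ℝ) + 1) * (a c ^ 2 + ∑ j ∈ S, a j ^ 2) ≤ (#S : ℝ) + 1 :=
    mul_le_of_le_one_right (by positivity) h₂
  simp only [sum_sub_distrib, sum_const, nsmul_eq_mul, mul_one]
  linarith

/-- The excesses of the squared gaps `> 1` of a vector of norm at most one add up to at most one:
the pairs with such a gap all share their first or all share their second entry. -/
lemma sum_gap_le_one {ι : Type*} [Fintype ι] [DecidableEq ι] {a : ι → ℝ}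
    (ha : ∑ i, a i ^ 2 ≤ 1) :
    ∑ e : ι × ι with 1 < a e.1 - a e.2, ((a e.1 - a e.2) ^ 2 - 1) ≤ 1 := by
  have hpair : ∀ i j, i ≠ j → a i ^ 2 + a j ^ 2 ≤ 1 := fun i j hij => by
    rw [← sum_pair (f := fun j => a j ^ 2) hij]
    exact (sum_le_univ_sum_of_nonneg fun i => sq_nonneg (a i)).trans ha
  have hsign : ∀ i j, 1 < a i - a j → 0 < a i ∧ a j < 0 := fun i j h => by
    have hij : i ≠ j := by rintro rfl; linarith
    have := hpair i j hij
    constructor <;> nlinarith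
  have hmeet : ∀ i j k l, 1 < a i - a j → 1 < a k - a l → i = k ∨ j = l := by
    intro i j k l h₁ h₂
    by_contra! hne
    obtain ⟨hi, hj⟩ := hsign i j h₁
    obtain ⟨hk, hl⟩ := hsign k l h₂
    have hij : i ≠ j := by rintro rfl; linarith
    have hil : i ≠ l := by rintro rfl; linarith
    have hkj : j ≠ k := by rintro rfl; linarith
    have hkl : k ≠ l := by rintro rfl; linarith
    have hfour : a i ^ 2 + (a j ^ 2 + (a k ^ 2 + a l ^ 2)) ≤ 1 := by
      refine le_trans (le_of_eq ?_)
        ((sum_le_univ_sum_of_nonneg (s := {i, j, k, l}) fun i => sq_nonneg (a i)).trans ha)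
      rw [sum_insert (by simp [hij, hne.1, hil]), sum_insert (by simp [hkj, hne.2]),
        sum_pair hkl]
    nlinarith [sq_nonneg (a i + a j), sq_nonneg (a k + a l)]
  set E : Finset (ι × ι) := {e : ι × ι | 1 < a e.1 - a e.2} with hE
  have hmem : ∀ e, e ∈ E ↔ 1 < a e.1 - a e.2 := by simp [hE]
  rcases E.eq_empty_or_nonempty with h0 | ⟨e, he⟩
  · simp [h0]
  have hstar : (∀ f ∈ E, f.1 = e.1) ∨ ∀ f ∈ E, f.2 = e.2 := by
    by_contra! hcon
    obtain ⟨⟨f, hf, hfe⟩, g, hg, hge⟩ := hcon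
    rw [hmem] at he hf hg
    have h₁ := (hmeet _ _ _ _ he hf).resolve_left hfe.symm
    have h₂ := (hmeet _ _ _ _ he hg).resolve_right hge.symm
    rcases hmeet _ _ _ _ hf hg with h | h
    · exact hfe (h.trans h₂.symm)
    · exact hge (h.symm.trans h₁.symm)
  rcases hstar with hs | hs
  · have hinj : Set.InjOn Prod.snd (E : Set (ι × ι)) := fun f hf g hg h =>
      Prod.ext ((hs f hf).trans (hs g hg).symm) h
    calc ∑ f ∈ E, ((a f.1 - a f.2) ^ 2 - 1)
        = ∑ j ∈ E.image Prod.snd, ((a e.1 - a j) ^ 2 - 1) := by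
          rw [sum_image hinj]
          exact sum_congr rfl fun f hf => by rw [hs f hf]
      _ ≤ 1 := sum_star_le_one ha _ _ fun hcon => by
          obtain ⟨f, hf, hfe⟩ := mem_image.1 hcon
          have := (hmem f).1 hf
          rw [hfe, hs f hf] at this
          linarith
  · have hinj : Set.InjOn Prod.fst (E : Set (ι × ι)) := fun f hf g hg h =>
      Prod.ext h ((hs f hf).trans (hs g hg).symm)
    calc ∑ f ∈ E, ((a f.1 - a f.2) ^ 2 - 1)
        = ∑ j ∈ E.image Prod.fst, ((a e.2 - a j) ^ 2 - 1) := by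
          rw [sum_image hinj]
          exact sum_congr rfl fun f hf => by rw [hs f hf]; ring
      _ ≤ 1 := sum_star_le_one ha _ _ fun hcon => by
          obtain ⟨f, hf, hfe⟩ := mem_image.1 hcon
          have := (hmem f).1 hf
          rw [hfe, hs f hf] at this
          linarith

/-- A quadratic form with nonnegative argument is bounded by the square of the sum as soon as its
row sums over subsets of the support are bounded by the cardinality (induction on the support,
subtracting the smallest nonzero coordinate). -/
lemma sum_mul_mul_le_sq_sum {κ : Type*} [Fintype κ] [DecidableEq κ] {c : κ → κ → ℝ}
    (hsymm : ∀ r s, c r s = c s r) (N : ℕ) : ∀ (x : κ → ℝ), (∀ r, 0 ≤ x r) →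
    #{r | x r ≠ 0} = N →
    (∀ K : Finset κ, (∀ r ∈ K, x r ≠ 0) → ∀ r ∈ K, ∑ s ∈ K, c r s ≤ #K) →
    ∑ r, ∑ s, x r * x s * c r s ≤ (∑ r, x r) ^ 2 := by
  induction N using Nat.strong_induction_on with
  | _ N ih =>
  intro x hx hN hc
  set K : Finset κ := {r | x r ≠ 0} with hK
  have hmem : ∀ r, r ∈ K ↔ x r ≠ 0 := by simp [hK]
  rcases K.eq_empty_or_nonempty with h0 | hne
  · have hz : ∀ r, x r = 0 := fun r => by
      by_contra h
      simpa [h0] using (hmem r).2 h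
    simp [hz]
  obtain ⟨m, hmK, hmin⟩ := K.exists_min_image x hne
  set t := x m with ht
  have htpos : 0 ≤ t := hx m
  set d : κ → ℝ := fun r => if r ∈ K then 1 else 0 with hd
  set y : κ → ℝ := fun r => x r - t * d r with hy
  have hyK : ∀ r, r ∉ K → x r = 0 := fun r hr => by
    by_contra h
    exact hr ((hmem r).2 h)
  have hynn : ∀ r, 0 ≤ y r := fun r => by
    by_cases hr : r ∈ K
    · simpa [hy, hd, hr] using hmin r hr
    · simp [hy, hd, hr, hyK r hr]
  have hysub : ∀ r, y r ≠ 0 → x r ≠ 0 := fun r h hr => by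
    have : r ∉ K := fun h' => (hmem r).1 h' hr
    exact h (by simp [hy, hd, this, hr])
  have hym : y m = 0 := by simp [hy, hd, hmK, ← ht]
  have hlt : #{r | y r ≠ 0} < N := by
    rw [← hN]
    refine card_lt_card ((ssubset_iff_of_subset ?_).2 ⟨m, hmK, by simp [hym]⟩)
    intro r hr
    exact (hmem r).2 (hysub r (by simpa using hr))
  have hrec := ih _ hlt y hynn rfl fun K' h => hc K' fun r hr => hysub r (h r hr)
  have hcK := hc K fun r hr => (hmem r).1 hr
  have hdsum : ∑ s, d s = #K := by simp [hd]
  have hcd : ∀ r, ∑ s, d s * c r s = ∑ s ∈ K, c r s := fun r => by simp [hd, ite_mul, sum_ite_mem]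
  have hcross : ∀ z : κ → ℝ, (∀ r, 0 ≤ z r) → (∀ r, r ∉ K → z r = 0) →
      ∑ r, ∑ s, z r * d s * c r s ≤ (∑ r, z r) * ∑ s, d s := fun z hz hzK => by
    rw [hdsum, sum_mul]
    refine sum_le_sum fun r _ => ?_
    simp only [mul_assoc, ← mul_sum, hcd]
    by_cases hr : r ∈ K
    · exact mul_le_mul_of_nonneg_left (hcK r hr) (hz r)
    · simp [hzK r hr]
  have h₁ := hcross y hynn fun r hr => by simp [hy, hd, hr, hyK r hr]
  have h₂ := hcross d (fun r => by simp only [hd]; split_ifs <;> norm_num)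
    fun r hr => by simp [hd, hr]
  have hxy : ∀ r, x r = y r + t * d r := fun r => by simp [hy]
  have hswap : ∑ r, ∑ s, d r * y s * c r s = ∑ r, ∑ s, y r * d s * c r s := by
    rw [sum_comm]
    exact sum_congr rfl fun r _ => sum_congr rfl fun s _ => by rw [hsymm s r]; ring
  have hquad : ∑ r, ∑ s, x r * x s * c r s = ∑ r, ∑ s, y r * y s * c r s
      + 2 * t * ∑ r, ∑ s, y r * d s * c r s + t ^ 2 * ∑ r, ∑ s, d r * d s * c r s := by
    calc ∑ r, ∑ s, x r * x s * c r s = ∑ r, ∑ s, y r * y s * c r s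
          + t * ∑ r, ∑ s, y r * d s * c r s + t * ∑ r, ∑ s, d r * y s * c r s
          + t ^ 2 * ∑ r, ∑ s, d r * d s * c r s := by
          simp only [mul_sum, ← sum_add_distrib]
          exact sum_congr rfl fun r _ => sum_congr rfl fun s _ => by rw [hxy r, hxy s]; ring
      _ = _ := by rw [hswap]; ring
  have hlin : ∑ r, x r = ∑ r, y r + t * ∑ r, d r := by
    simp only [mul_sum, ← sum_add_distrib]
    exact sum_congr rfl fun r _ => hxy r
  rw [hquad, hlin]
  nlinarith [mul_le_mul_of_nonneg_left h₁ htpos, mul_le_mul_of_nonneg_left h₂ (sq_nonneg t)]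

lemma Matrix.IsSymm.trace_mul_self {ι : Type*} [Fintype ι] {B : Matrix ι ι ℝ} (hB : B.IsSymm) :
    trace (B * B) = ∑ i, ∑ j, B i j ^ 2 := by
  simp only [trace, diag_apply, mul_apply]
  exact sum_congr rfl fun i _ => sum_congr rfl fun j _ => by rw [hB.apply i j, sq]

/-- Bessel's inequality for an off-diagonal entry of trace-orthonormal symmetric matrices. -/
lemma sum_sq_entry_le_half {ι κ : Type*} [Fintype ι] [DecidableEq ι] [DecidableEq κ]
    {B : κ → Matrix ι ι ℝ} {J : Finset κ} (hB : ∀ s, (B s).IsSymm)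
    (horth : ∀ r ∈ J, ∀ s ∈ J, trace (B r * B s) = if r = s then 1 else 0)
    {i j : ι} (hij : i ≠ j) : ∑ s ∈ J, B s i j ^ 2 ≤ 1 / 2 := by
  set C : Matrix ι ι ℝ := ∑ s ∈ J, B s i j • B s with hC
  set Q := ∑ s ∈ J, B s i j ^ 2 with hQ
  have hCsymm : C.IsSymm := by
    simp only [IsSymm, hC, transpose_sum, transpose_smul, (hB _).eq]
  have hCij : C i j = Q := by
    simp [hC, hQ, Matrix.sum_apply, sq]
  have htr : trace (C * C) = Q := by
    simp only [hC, sum_mul, mul_sum, trace_sum, smul_mul, Matrix.mul_smul, trace_smul, smul_eq_mul]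
    refine sum_congr rfl fun r hr => ?_
    rw [sum_congr rfl fun s hs => by rw [horth s hs r hr]]
    simp [hr, sq]
  rw [hCsymm.trace_mul_self, ← Fintype.sum_prod_type' (f := fun k l => C k l ^ 2)] at htr
  have hpair : ∑ e ∈ {(i, j), (j, i)}, C e.1 e.2 ^ 2 ≤ ∑ e : ι × ι, C e.1 e.2 ^ 2 :=
    sum_le_univ_sum_of_nonneg fun e => sq_nonneg _
  rw [sum_pair (by simp [hij]), htr, hCsymm.apply i j, hCij] at hpair
  nlinarith

lemma sum_sq_sub_mul_sq_entry_le {ι κ : Type*} [Fintype ι] [DecidableEq ι] [DecidableEq κ]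
    {a : ι → ℝ} (ha : ∑ i, a i ^ 2 ≤ 1)
    {B : κ → Matrix ι ι ℝ} {J : Finset κ} (hB : ∀ s, (B s).IsSymm)
    (horth : ∀ r ∈ J, ∀ s ∈ J, trace (B r * B s) = if r = s then 1 else 0) :
    ∑ s ∈ J, ∑ i, ∑ j, (a i - a j) ^ 2 * B s i j ^ 2 ≤ #J + 1 := by
  set Q : ι × ι → ℝ := fun e => ∑ s ∈ J, B s e.1 e.2 ^ 2 with hQ
  have htot : ∑ e, Q e = #J := by
    rw [hQ, sum_comm, card_eq_sum_ones, Nat.cast_sum]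
    refine sum_congr rfl fun s hs => ?_
    rw [Fintype.sum_prod_type, ← (hB s).trace_mul_self, horth s hs s hs]
    simp
  have hlhs : ∑ s ∈ J, ∑ i, ∑ j, (a i - a j) ^ 2 * B s i j ^ 2
      = ∑ e : ι × ι, (a e.1 - a e.2) ^ 2 * Q e := by
    simp only [hQ, mul_sum]
    rw [sum_comm (s := univ) (t := J)]
    exact sum_congr rfl fun s _ =>
      (Fintype.sum_prod_type fun e : ι × ι => (a e.1 - a e.2) ^ 2 * B s e.1 e.2 ^ 2).symm
  have hterm : ∀ e : ι × ι, (a e.1 - a e.2) ^ 2 * Q e ≤ Q e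
      + ((if 1 < a e.1 - a e.2 then ((a e.1 - a e.2) ^ 2 - 1) / 2 else 0)
        + if 1 < a e.2 - a e.1 then ((a e.2 - a e.1) ^ 2 - 1) / 2 else 0) := by
    intro e
    have hQ0 : 0 ≤ Q e := sum_nonneg fun s _ => sq_nonneg _
    have hQh : a e.1 ≠ a e.2 → Q e ≤ 1 / 2 := fun h =>
      sum_sq_entry_le_half hB horth fun h' => h (by rw [h'])
    split_ifs with h₁ h₂ h₂
    · linarith
    · have := hQh (by intro h; linarith)
      have hsq : 1 ≤ (a e.1 - a e.2) ^ 2 := by nlinarith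
      nlinarith
    · have := hQh (by intro h; linarith)
      have hsq : 1 ≤ (a e.2 - a e.1) ^ 2 := by nlinarith
      rw [← neg_sub (a e.2), neg_sq]
      nlinarith
    · have : (a e.1 - a e.2) ^ 2 ≤ 1 := by nlinarith
      nlinarith
  have hgap := sum_gap_le_one ha
  rw [sum_filter] at hgap
  have hfst : ∑ e : ι × ι, (if 1 < a e.1 - a e.2 then ((a e.1 - a e.2) ^ 2 - 1) / 2 else 0)
      ≤ 1 / 2 := by
    calc _ = (∑ e : ι × ι, if 1 < a e.1 - a e.2 then (a e.1 - a e.2) ^ 2 - 1 else 0) / 2 := by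
          rw [sum_div]
          exact sum_congr rfl fun e _ => by split_ifs <;> simp
      _ ≤ 1 / 2 := by linarith
  have hsnd : ∑ e : ι × ι, (if 1 < a e.2 - a e.1 then ((a e.2 - a e.1) ^ 2 - 1) / 2 else 0)
      ≤ 1 / 2 := by
    rw [← (Equiv.prodComm ι ι).sum_comp]
    exact hfst
  calc _ = _ := hlhs
    _ ≤ _ := sum_le_sum fun e _ => hterm e
    _ ≤ #J + 1 := by
      rw [sum_add_distrib, sum_add_distrib, htot]
      linarith

/-- Squared Frobenius norm of the commutator of two symmetric matrices. -/
noncomputable def commNormSq {ι : Type*} [Fintype ι] (A B : Matrix ι ι ℝ) : ℝ :=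
  -trace ((A * B - B * A) * (A * B - B * A))

lemma commNormSq_comm {ι : Type*} [Fintype ι] (A B : Matrix ι ι ℝ) :
    commNormSq A B = commNormSq B A := by
  rw [commNormSq, commNormSq, ← neg_sub (B * A) (A * B), neg_mul_neg]

lemma commNormSq_smul {ι : Type*} [Fintype ι] (x y : ℝ) (A B : Matrix ι ι ℝ) :
    commNormSq (x • A) (y • B) = x ^ 2 * y ^ 2 * commNormSq A B := by
  have h : x • A * y • B - y • B * x • A = (x * y) • (A * B - B * A) := by
    simp only [smul_mul_smul_comm, smul_sub, mul_comm y x]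
  rw [commNormSq, commNormSq, h, smul_mul_smul_comm, trace_smul, smul_eq_mul]
  ring

lemma commNormSq_diagonal {ι : Type*} [Fintype ι] [DecidableEq ι] (a : ι → ℝ)
    {B : Matrix ι ι ℝ} (hB : B.IsSymm) :
    commNormSq (diagonal a) B = ∑ i, ∑ j, (a i - a j) ^ 2 * B i j ^ 2 := by
  have h : ∀ i j, (diagonal a * B - B * diagonal a) i j = (a i - a j) * B i j := fun i j => by
    rw [Matrix.sub_apply, diagonal_mul, mul_diagonal]
    ring
  rw [commNormSq, trace, ← sum_neg_distrib]
  refine sum_congr rfl fun i _ => ?_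
  rw [diag_apply, mul_apply, ← sum_neg_distrib]
  exact sum_congr rfl fun j _ => by rw [h, h, hB.apply i j]; ring

/-- A real symmetric matrix is diagonalized by an orthogonal matrix. -/
lemma Matrix.IsSymm.exists_orthogonal_diagonal {ι : Type*} [Fintype ι] [DecidableEq ι]
    {A : Matrix ι ι ℝ} (hA : A.IsSymm) :
    ∃ (U : Matrix ι ι ℝ) (a : ι → ℝ), U * Uᵀ = 1 ∧ Uᵀ * A * U = diagonal a := by
  have hH : A.IsHermitian := by rw [IsHermitian, conjTranspose_eq_transpose_of_trivial]; exact hA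
  refine ⟨hH.eigenvectorUnitary, hH.eigenvalues, ?_, ?_⟩
  · have := Unitary.coe_mul_star_self hH.eigenvectorUnitary
    rwa [Unitary.coe_star, star_eq_conjTranspose, conjTranspose_eq_transpose_of_trivial] at this
  · have := hH.conjStarAlgAut_star_eigenvectorUnitary
    rw [Unitary.conjStarAlgAut_star_apply, star_eq_conjTranspose,
      conjTranspose_eq_transpose_of_trivial] at this
    exact this

lemma trace_conj_mul_conj_s2 {ι : Type*} [Fintype ι] [DecidableEq ι] {U : Matrix ι ι ℝ}
    (hU : U * Uᵀ = 1) (A B : Matrix ι ι ℝ) :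
    trace ((Uᵀ * A * U) * (Uᵀ * B * U)) = trace (A * B) := by
  have h : (Uᵀ * A * U) * (Uᵀ * B * U) = Uᵀ * (A * (U * Uᵀ) * B * U) := by
    simp only [Matrix.mul_assoc]
  rw [h, hU, Matrix.mul_one, trace_mul_comm, Matrix.mul_assoc, hU, Matrix.mul_one]

lemma commNormSq_conj {ι : Type*} [Fintype ι] [DecidableEq ι] {U : Matrix ι ι ℝ}
    (hU : U * Uᵀ = 1) (A B : Matrix ι ι ℝ) :
    commNormSq (Uᵀ * A * U) (Uᵀ * B * U) = commNormSq A B := by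
  have hmul : ∀ A B : Matrix ι ι ℝ, (Uᵀ * A * U) * (Uᵀ * B * U) = Uᵀ * (A * B) * U := fun A B => by
    have h : (Uᵀ * A * U) * (Uᵀ * B * U) = Uᵀ * (A * (U * Uᵀ) * B) * U := by
      simp only [Matrix.mul_assoc]
    rw [h, hU, Matrix.mul_one]
  rw [commNormSq, hmul, hmul, ← Matrix.sub_mul, ← Matrix.mul_sub, trace_conj_mul_conj_s2 hU,
    commNormSq]

lemma sum_commNormSq_le_card_add_one {ι κ : Type*} [Fintype ι] [DecidableEq ι] [DecidableEq κ]
    {A : Matrix ι ι ℝ} (hA : A.IsSymm) (hA1 : trace (A * A) ≤ 1)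
    {B : κ → Matrix ι ι ℝ} {J : Finset κ} (hB : ∀ s, (B s).IsSymm)
    (horth : ∀ r ∈ J, ∀ s ∈ J, trace (B r * B s) = if r = s then 1 else 0) :
    ∑ s ∈ J, commNormSq A (B s) ≤ #J + 1 := by
  obtain ⟨U, a, hU, hd⟩ := hA.exists_orthogonal_diagonal
  have hB' : ∀ s, (Uᵀ * B s * U).IsSymm := fun s => by
    rw [IsSymm, transpose_mul, transpose_mul, transpose_transpose, (hB s).eq, Matrix.mul_assoc]
  have ha : ∑ i, a i ^ 2 ≤ 1 := by
    rw [← trace_conj_mul_conj_s2 hU, hd, diagonal_mul_diagonal, trace_diagonal] at hA1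
    simpa only [sq] using hA1
  refine le_trans (le_of_eq (sum_congr rfl fun s _ => ?_))
    (sum_sq_sub_mul_sq_entry_le ha (B := fun s => Uᵀ * B s * U) hB' fun r hr s hs => by
      rw [trace_conj_mul_conj_s2 hU, horth r hr s hs])
  rw [← commNormSq_diagonal a (hB' s), ← hd, commNormSq_conj hU]

lemma sum_commNormSq_le_of_orthogonal {ι κ : Type*} [Fintype ι] [DecidableEq ι] [Fintype κ]
    [DecidableEq κ] {A : κ → Matrix ι ι ℝ} (hA : ∀ r, (A r).IsSymm)
    (horth : ∀ r s, r ≠ s → trace (A r * A s) = 0) :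
    ∑ r, ∑ s, commNormSq (A r) (A s) ≤ (∑ r, trace (A r * A r)) ^ 2 := by
  set x : κ → ℝ := fun r => trace (A r * A r) with hx
  have hx0 : ∀ r, 0 ≤ x r := fun r => by
    simp only [hx, (hA r).trace_mul_self]
    positivity
  set u : κ → Matrix ι ι ℝ := fun r => (√(x r))⁻¹ • A r with hu
  have husymm : ∀ r, (u r).IsSymm := fun r => (hA r).smul _
  have huA : ∀ r, A r = √(x r) • u r := fun r => by
    by_cases hr : x r = 0
    · have h0 : A r = 0 := by
        simp only [hx, (hA r).trace_mul_self] at hr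
        ext i j
        have hi := (sum_eq_zero_iff_of_nonneg fun i _ =>
          sum_nonneg fun j _ => sq_nonneg (A r i j)).1 hr i (mem_univ i)
        have hij := (sum_eq_zero_iff_of_nonneg fun j _ => sq_nonneg (A r i j)).1 hi j (mem_univ j)
        simpa using hij
      simp [hu, h0]
    · have : √(x r) ≠ 0 := (Real.sqrt_pos.2 (lt_of_le_of_ne (hx0 r) (Ne.symm hr))).ne'
      simp [hu, smul_smul, mul_inv_cancel₀ this]
  have hunit : ∀ r, x r ≠ 0 → trace (u r * u r) = 1 := fun r hr => by
    simp only [hu, smul_mul_smul_comm, trace_smul, smul_eq_mul, ← mul_inv,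
      Real.mul_self_sqrt (hx0 r)]
    exact inv_mul_cancel₀ hr
  have hne : ∀ r s, r ≠ s → trace (u r * u s) = 0 := fun r s hrs => by
    simp only [hu, smul_mul_smul_comm, trace_smul, horth r s hrs, smul_zero]
  have hmain := sum_mul_mul_le_sq_sum (c := fun r s => commNormSq (u r) (u s))
    (fun r s => commNormSq_comm _ _) _ x hx0 rfl fun K hK r hr => by
      have h := sum_commNormSq_le_card_add_one (husymm r) (hunit r (hK r hr)).le
        (J := K.erase r) husymm fun p hp q hq => by
          split_ifs with h
          · rw [← h, hunit p (hK p (mem_of_mem_erase hp))]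
          · exact hne p q h
      have hself : commNormSq (u r) (u r) = 0 := by simp [commNormSq]
      rw [← add_sum_erase K _ hr, hself, zero_add]
      refine h.trans (le_of_eq ?_)
      exact_mod_cast card_erase_add_one hr
  refine le_trans (le_of_eq (sum_congr rfl fun r _ => sum_congr rfl fun s _ => ?_)) hmain
  conv_lhs => rw [huA r, huA s, commNormSq_smul, Real.sq_sqrt (hx0 r), Real.sq_sqrt (hx0 s)]

/-- Double sums of a bilinear expression are invariant under an orthogonal change of family. -/
lemma sum_bilin_orthogonal {κ V : Type*} [Fintype κ] [DecidableEq κ] [AddCommGroup V] [Module ℝ V]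
    {O : Matrix κ κ ℝ} (hO : O * Oᵀ = 1) (f : V →ₗ[ℝ] V →ₗ[ℝ] ℝ) (v : κ → V) :
    ∑ r, f (∑ a, O a r • v a) (∑ a, O a r • v a) = ∑ r, f (v r) (v r) := by
  have hO' : ∀ a b, ∑ r, O a r * O b r = if a = b then 1 else 0 := fun a b => by
    have := congrFun (congrFun hO a) b
    simpa [mul_apply, one_apply] using this
  calc ∑ r, f (∑ a, O a r • v a) (∑ a, O a r • v a)
      = ∑ r, ∑ a, ∑ b, O a r * O b r * f (v a) (v b) := by
        simp only [map_sum, map_smul, LinearMap.sum_apply, LinearMap.smul_apply, smul_eq_mul,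
          mul_sum, mul_assoc]
        refine sum_congr rfl fun r _ => ?_
        rw [sum_comm]
        exact sum_congr rfl fun a _ => sum_congr rfl fun b _ => by ring
    _ = ∑ a, ∑ b, (∑ r, O a r * O b r) * f (v a) (v b) := by
        simp only [sum_mul]
        rw [sum_comm]
        exact sum_congr rfl fun a _ => sum_comm
    _ = ∑ r, f (v r) (v r) := by simp [hO']

/-- The trace form on square matrices. -/
noncomputable def matrixTraceForm (ι : Type*) [Fintype ι] :
    Matrix ι ι ℝ →ₗ[ℝ] Matrix ι ι ℝ →ₗ[ℝ] ℝ :=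
  (LinearMap.mul ℝ (Matrix ι ι ℝ)).compr₂ (traceLinearMap ι ℝ ℝ)

lemma matrixTraceForm_apply {ι : Type*} [Fintype ι] (A B : Matrix ι ι ℝ) :
    matrixTraceForm ι A B = trace (A * B) := rfl

/-- The commutator with a fixed matrix, as a linear map. -/
def commLinear {ι : Type*} [Fintype ι] (A : Matrix ι ι ℝ) : Matrix ι ι ℝ →ₗ[ℝ] Matrix ι ι ℝ :=
  LinearMap.mulLeft ℝ A - LinearMap.mulRight ℝ A

lemma commNormSq_eq_form {ι : Type*} [Fintype ι] (A B : Matrix ι ι ℝ) :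
    commNormSq A B = -(matrixTraceForm ι).compl₁₂ (commLinear A) (commLinear A) B B := rfl

lemma sum_commNormSq_orthogonal {ι κ : Type*} [Fintype ι] [Fintype κ] [DecidableEq κ]
    {O : Matrix κ κ ℝ} (hO : O * Oᵀ = 1) (A : κ → Matrix ι ι ℝ) :
    ∑ r, ∑ s, commNormSq (∑ a, O a r • A a) (∑ a, O a s • A a)
      = ∑ r, ∑ s, commNormSq (A r) (A s) := by
  have h : ∀ X : Matrix ι ι ℝ,
      ∑ s, commNormSq X (∑ a, O a s • A a) = ∑ s, commNormSq X (A s) := fun X => by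
    simp only [commNormSq_eq_form, sum_neg_distrib, sum_bilin_orthogonal hO]
  simp only [h]
  rw [sum_comm]
  conv_rhs => rw [sum_comm]
  refine sum_congr rfl fun s _ => ?_
  simp only [commNormSq_comm _ (A s), h]

/-- The DDVV inequality for families of real symmetric matrices. -/
theorem sum_commNormSq_le {ι κ : Type*} [Fintype ι] [DecidableEq ι] [Fintype κ]
    [DecidableEq κ] {A : κ → Matrix ι ι ℝ} (hA : ∀ r, (A r).IsSymm) :
    ∑ r, ∑ s, commNormSq (A r) (A s) ≤ (∑ r, trace (A r * A r)) ^ 2 := by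
  set G : Matrix κ κ ℝ := of fun r s => trace (A r * A s) with hG
  have hGs : G.IsSymm := by
    ext r s
    simp [hG, trace_mul_comm (A r)]
  obtain ⟨O, g, hO, hd⟩ := hGs.exists_orthogonal_diagonal
  have key := sum_commNormSq_le_of_orthogonal (A := fun r => ∑ a, O a r • A a)
    (fun r => by simp only [IsSymm, transpose_sum, transpose_smul, (hA _).eq])
    fun r s hrs => by
      have := congrFun (congrFun hd r) s
      rw [diagonal_apply_ne _ hrs] at this
      rw [← this]
      simp only [mul_apply, transpose_apply, hG, of_apply, Matrix.mul_sum,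
        trace_sum, smul_mul_smul_comm, trace_smul, smul_eq_mul, sum_mul]
      rw [sum_comm]
      exact sum_congr rfl fun a _ => sum_congr rfl fun b _ => by ring
  rw [sum_commNormSq_orthogonal hO] at key
  have htr := sum_bilin_orthogonal hO (matrixTraceForm ι) A
  simp only [matrixTraceForm_apply] at htr
  rwa [htr] at key

lemma two_mul_sum_lt {n : ℕ} {F : Fin n → Fin n → ℝ} (hF : ∀ i j, F i j = F j i) :
    2 * (∑ i, ∑ j, if i < j then F i j else 0) = ∑ i, ∑ j, F i j - ∑ i, F i i := by
  have hswap : (∑ i, ∑ j, if i < j then F i j else 0) = ∑ i, ∑ j, if j < i then F i j else 0 := by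
    rw [sum_comm]
    exact sum_congr rfl fun i _ => sum_congr rfl fun j _ => by rw [hF j i]
  have hdiag : ∑ i, F i i = ∑ i, ∑ j, if i = j then F i j else 0 := by simp
  rw [two_mul]
  nth_rw 2 [hswap]
  rw [hdiag, eq_sub_iff_add_eq]
  simp only [← sum_add_distrib]
  refine sum_congr rfl fun i _ => sum_congr rfl fun j _ => ?_
  rcases lt_trichotomy i j with h | h | h
  · simp [h, h.not_gt, h.ne]
  · simp [h]
  · simp [h, h.not_gt, h.ne']

lemma two_mul_sqrt_KN_le {n p : ℕ} {A : Fin p → Matrix (Fin n) (Fin n) ℝ}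
    (hA : ∀ r, (A r).IsSymm) : 2 * √(KN A) ≤ ∑ r, trace (A r * A r) := by
  have hS : 0 ≤ ∑ r, trace (A r * A r) := sum_nonneg fun r _ => by
    rw [(hA r).trace_mul_self]
    positivity
  have hKN : KN A = (1 / 4) * ∑ r, ∑ s, commNormSq (A r) (A s) := by
    simp only [KN, commNormSq, sum_neg_distrib]
    ring
  have hle : √(KN A) ≤ (∑ r, trace (A r * A r)) / 2 := by
    refine Real.sqrt_le_iff.2 ⟨by linarith, ?_⟩
    rw [hKN]
    linarith [sum_commNormSq_le hA, div_pow (∑ r, trace (A r * A r)) 2 2]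
  linarith

/-- **Generalized Wintgen inequality, minimal case.**
If moreover the submanifold is minimal (the mean curvature vector vanishes, i.e. every
shape operator is trace-free, hypothesis `hmin`), then
`ρ + ρ_N ≤ (2/(n(m-2))) ∑_j Ric~(e_j,e_j) - 2τ~/((m-1)(m-2))`. -/
theorem wintgen_rhoN_conformally_flat_minimal {n m : ℕ}
    (hn : 3 ≤ n) (hm : 4 ≤ m) (hnm : n ≤ m)
    (Rt : Fin m → Fin m → Fin m → Fin m → ℝ)
    (R : Fin n → Fin n → Fin n → Fin n → ℝ)
    (h : Fin (m - n) → Matrix (Fin n) (Fin n) ℝ)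
    (hsymm : ∀ r, (h r).IsSymm)
    (hmin : ∀ r : Fin (m - n), ∑ i : Fin n, h r i i = 0)
    (weyl : ∀ x y z w : Fin m, Rt x y z w =
      (1 / ((m : ℝ) - 2)) *
        (ambRicci Rt y z * kdelta x w - ambRicci Rt x z * kdelta y w
          + ambRicci Rt x w * kdelta y z - ambRicci Rt y w * kdelta x z)
      - (2 * ambScalar Rt / (((m : ℝ) - 1) * ((m : ℝ) - 2))) *
          (kdelta y z * kdelta x w - kdelta x z * kdelta y w))
    (gauss : ∀ i j k l : Fin n, R i j k l =
      Rt (Fin.castLE hnm i) (Fin.castLE hnm j) (Fin.castLE hnm k) (Fin.castLE hnm l)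
      + ∑ r : Fin (m - n), (h r i l * h r j k - h r i k * h r j l)) :
    normScalarCurv R + rhoN h ≤ 2 / ((n : ℝ) * ((m : ℝ) - 2)) *
          ∑ j : Fin n, ambRicci Rt (Fin.castLE hnm j) (Fin.castLE hnm j)
      - 2 * ambScalar Rt / (((m : ℝ) - 1) * ((m : ℝ) - 2)) := by
  set ric : Fin n → ℝ := fun i => ambRicci Rt (Fin.castLE hnm i) (Fin.castLE hnm i) with hric
  set c : ℝ := 2 * ambScalar Rt / (((m : ℝ) - 1) * ((m : ℝ) - 2)) with hc
  set S : ℝ := ∑ r, trace (h r * h r) with hS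
  set F : Fin n → Fin n → ℝ := fun i j => (1 / ((m : ℝ) - 2)) * (ric j + ric i) - c
    + ∑ r, (h r i i * h r j j - h r i j * h r i j) with hF
  have hRF : ∀ i j, i < j → R i j j i = F i j := fun i j hij => by
    have hne : Fin.castLE hnm i ≠ Fin.castLE hnm j := fun h' => hij.ne (Fin.castLE_injective hnm h')
    rw [gauss, weyl]
    simp only [hF, hric, kdelta, hne, hne.symm, if_true, if_false, (hsymm _).apply i j]
    ring
  have hFsymm : ∀ i j, F i j = F j i := fun i j => by
    simp only [hF, (hsymm _).apply i j, add_comm (ric j), mul_comm (h _ i i)]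
  have hscal : scalarCurv R = ∑ i, ∑ j, if i < j then F i j else 0 :=
    sum_congr rfl fun i _ => sum_congr rfl fun j _ => by
      split_ifs with hij
      · exact hRF i j hij
      · rfl
  have hsecond : ∑ i, ∑ j, ∑ r, (h r i i * h r j j - h r i j * h r i j) = -S := by
    calc ∑ i, ∑ j, ∑ r, (h r i i * h r j j - h r i j * h r i j)
        = ∑ r, ∑ i, ∑ j, (h r i i * h r j j - h r i j * h r i j) := by
          rw [sum_comm (s := univ (α := Fin (m - n)))]
          exact sum_congr rfl fun i _ => sum_comm
      _ = -S := by
          rw [hS, ← sum_neg_distrib]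
          refine sum_congr rfl fun r _ => ?_
          simp only [sum_sub_distrib, ← mul_sum, hmin r, mul_zero, zero_sub, sum_neg_distrib,
            (hsymm r).trace_mul_self, sq]
  have hall : ∑ i, ∑ j, F i j = 2 * n * (1 / ((m : ℝ) - 2)) * ∑ i, ric i - n ^ 2 * c - S := by
    simp only [hF, sum_add_distrib, sum_sub_distrib, ← mul_sum, sum_const, card_univ,
      Fintype.card_fin, nsmul_eq_mul]
    simp only [← sum_sub_distrib, hsecond]
    ring
  have hdiag : ∑ i, F i i = 2 * (1 / ((m : ℝ) - 2)) * ∑ i, ric i - n * c := by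
    simp only [hF, sub_self, add_zero, sum_sub_distrib, ← mul_sum,
      sum_add_distrib, sum_const, card_univ, Fintype.card_fin, nsmul_eq_mul]
    ring
  have htau : 2 * scalarCurv R
      = 2 * (n - 1) * (1 / ((m : ℝ) - 2)) * ∑ i, ric i - n * (n - 1) * c - S := by
    rw [hscal, two_mul_sum_lt hFsymm, hall, hdiag]
    ring
  have hn3 : (3 : ℝ) ≤ n := by exact_mod_cast hn
  have hm4 : (4 : ℝ) ≤ m := by exact_mod_cast hm
  have hn1 : (n : ℝ) - 1 ≠ 0 := by linarith
  have hm2 : (m : ℝ) - 2 ≠ 0 := by linarith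
  have hpos : 0 < (n : ℝ) * ((n : ℝ) - 1) := by nlinarith
  have hsplit : normScalarCurv R + rhoN h = 2 / ((n : ℝ) * ((m : ℝ) - 2)) * ∑ i, ric i - c
      + (2 * √(KN h) - S) / ((n : ℝ) * ((n : ℝ) - 1)) := by
    rw [normScalarCurv, rhoN, htau]
    field_simp
    ring
  rw [hsplit]
  have := div_nonpos_of_nonpos_of_nonneg (sub_nonpos.2 (two_mul_sqrt_KN_le hsymm)) hpos.le
  linarith
end
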